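/- Let 𝒳 = (X, o_X, μ_X) and 𝒴 = (Y, o_Y, μ_Y) be compact pmm spaces with μ_X(X) ≤ μ_Y(Y), and let ε := dc(𝒳,𝒴). Then there exist a correspondence R between X and Y with (o_X, o_Y) ∈ R and a Borel measure α on X × Y such that dis(R) ≤ 2ε, D(α;μ_X,μ_Y) + α(Rᶜ) ≤ ε, π₁_*α = μ_X and π₂_*α ≤ μ_Y. -/

import Mathlib

open MeasureTheory Topology Filter

noncomputable section

/-- Prokhorov distance between finite Borel measures on a metric space. -/
def prokhorovDist {Z : Type*} [MetricSpace Z] [MeasurableSpace Z]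
    (μ ν : Measure Z) : ℝ :=
  sInf {ε : ℝ | 0 < ε ∧ ∀ A : Set Z, IsClosed A →
    μ A ≤ ν (Metric.cthickening ε A) + ENNReal.ofReal ε ∧
    ν A ≤ μ (Metric.cthickening ε A) + ENNReal.ofReal ε}

/-- A pointed measured metric space: a metric space with a distinguished point and a Borel
measure. -/
structure PMM : Type 1 where
  carrier : Type
  metric : MetricSpace carrier
  basepoint : carrier
  meas : @Measure carrier
    (@borel carrier metric.toPseudoMetricSpace.toUniformSpace.toTopologicalSpace)

attribute [instance] PMM.metric

instance PMM.instMeasurableSpace (𝒳 : PMM) : MeasurableSpace 𝒳.carrier := borel 𝒳.carrier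

instance PMM.instBorelSpace (𝒳 : PMM) : BorelSpace 𝒳.carrier := ⟨rfl⟩

/-- A pmm space is boundedly compact if every closed ball is compact and has finite measure. -/
def PMM.BoundedlyCompact (𝒳 : PMM) : Prop :=
  (∀ (x : 𝒳.carrier) (r : ℝ), IsCompact (Metric.closedBall x r)) ∧
  (∀ (x : 𝒳.carrier) (r : ℝ), 𝒳.meas (Metric.closedBall x r) ≠ ⊤)

/-- A pmm space is compact if its carrier is compact and its measure is finite. -/
def PMM.IsCompactPMM (𝒳 : PMM) : Prop :=
  CompactSpace 𝒳.carrier ∧ 𝒳.meas Set.univ ≠ ⊤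

/-- A pair of maps of two pmm spaces into a common metric space. -/
structure GHPEmbedding (𝒳 𝒴 : PMM) : Type 1 where
  Z : Type
  mZ : MetricSpace Z
  f : 𝒳.carrier → Z
  g : 𝒴.carrier → Z

attribute [instance] GHPEmbedding.mZ

/-- Both maps of a `GHPEmbedding` are isometric embeddings. -/
def GHPEmbedding.IsIsometric {𝒳 𝒴 : PMM} (e : GHPEmbedding 𝒳 𝒴) : Prop :=
  Isometry e.f ∧ Isometry e.g

/-- The quantity `max(d(f o_X, g o_Y), dH(f(X), g(Y)), dP(f_*μ_X, g_*μ_Y))` associated to a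
pair of embeddings into a common space. -/
def GHPEmbedding.value {𝒳 𝒴 : PMM} (e : GHPEmbedding 𝒳 𝒴) : ℝ :=
  letI : MeasurableSpace e.Z := borel e.Z
  max (dist (e.f 𝒳.basepoint) (e.g 𝒴.basepoint))
    (max (Metric.hausdorffDist (Set.range e.f) (Set.range e.g))
      (prokhorovDist (𝒳.meas.map e.f) (𝒴.meas.map e.g)))

/-- The Gromov-Hausdorff-Prokhorov distance of compact pmm spaces. -/
def cGHP (𝒳 𝒴 : PMM) : ℝ :=
  sInf {x : ℝ | ∃ e : GHPEmbedding 𝒳 𝒴, e.IsIsometric ∧ x = e.value}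

/-- A pmm-subspace of a pmm space `𝒳`: a subset containing the basepoint together with a
measure `≤ 𝒳.meas` supported on the subset. -/
structure SubPMM (𝒳 : PMM) where
  set : Set 𝒳.carrier
  root_mem : 𝒳.basepoint ∈ set
  meas : Measure 𝒳.carrier
  meas_le : meas ≤ 𝒳.meas
  supported : meas setᶜ = 0

/-- The pmm space associated to a pmm-subspace. -/
def SubPMM.toPMM {𝒳 : PMM} (S : SubPMM 𝒳) : PMM where
  carrier := ↥S.set
  metric := inferInstance
  basepoint := ⟨𝒳.basepoint, S.root_mem⟩
  meas := @Measure.comap ↥S.set 𝒳.carrier (borel ↥S.set) inferInstance Subtype.val S.meas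

/-- The pmm-subspace ordering: inclusion of sets and inequality of measures. -/
instance {𝒳 : PMM} : LE (SubPMM 𝒳) :=
  ⟨fun S T => S.set ⊆ T.set ∧ S.meas ≤ T.meas⟩

/-- Compactness of a pmm-subspace. -/
def SubPMM.IsCompactSub {𝒳 : PMM} (S : SubPMM 𝒳) : Prop :=
  IsCompact S.set ∧ S.meas Set.univ ≠ ⊤

/-- The closed ball of radius `r` around the basepoint, as a pmm-subspace (for `r ≥ 0` the
underlying set is exactly the closed ball; the basepoint is inserted so that the definition
makes sense for all `r`). -/
def PMM.ballSub (𝒳 : PMM) (r : ℝ) : SubPMM 𝒳 where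
  set := insert 𝒳.basepoint (Metric.closedBall 𝒳.basepoint r)
  root_mem := Set.mem_insert _ _
  meas := 𝒳.meas.restrict (insert 𝒳.basepoint (Metric.closedBall 𝒳.basepoint r))
  meas_le := Measure.restrict_le_self
  supported := by
    rw [Measure.restrict_apply ((measurableSet_closedBall.insert 𝒳.basepoint).compl),
      Set.compl_inter_self]
    simp

/-- The quantity `a(ε, r; 𝒳, 𝒴)`. -/
def aFun (ε r : ℝ) (𝒳 𝒴 : PMM) : ℝ :=
  sInf {x : ℝ | ∃ Y' : SubPMM 𝒴, Y'.IsCompactSub ∧ 𝒴.ballSub (r - ε) ≤ Y' ∧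
    x = cGHP ((𝒳.ballSub r).toPMM) Y'.toPMM}

/-- The quantity `a_ε(𝒳, 𝒴) = a(ε, 1/ε; 𝒳, 𝒴)`. -/
def aEps (ε : ℝ) (𝒳 𝒴 : PMM) : ℝ := aFun ε (1 / ε) 𝒳 𝒴

/-- The Gromov-Hausdorff-Prokhorov distance of boundedly compact pmm spaces
(with `inf ∅ = 1`). -/
def GHP (𝒳 𝒴 : PMM) : ℝ :=
  sInf (insert 1 {ε : ℝ | ε ∈ Set.Ioc (0 : ℝ) 1 ∧ max (aEps ε 𝒳 𝒴) (aEps ε 𝒴 𝒳) < ε / 2})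

/-- Two pmm spaces are GHP-isometric if there is a root-preserving measure-preserving
surjective isometry between them. -/
def GHPIsometric (𝒳 𝒴 : PMM) : Prop :=
  ∃ ρ : 𝒳.carrier → 𝒴.carrier, Isometry ρ ∧ Function.Surjective ρ ∧
    ρ 𝒳.basepoint = 𝒴.basepoint ∧ 𝒳.meas.map ρ = 𝒴.meas

/-- `r` is a continuity radius of a pmm space. -/
def PMM.ContinuityRadius (𝒳 : PMM) (r : ℝ) : Prop :=
  0 < r ∧ Metric.closedBall 𝒳.basepoint r = closure (Metric.ball 𝒳.basepoint r) ∧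
    𝒳.meas (Metric.closedBall 𝒳.basepoint r \ Metric.ball 𝒳.basepoint r) = 0

/-- Total variation distance between finite measures. -/
def tvDist {Z : Type*} [MeasurableSpace Z] (μ ν : Measure Z) : ℝ :=
  sSup {x : ℝ | ∃ A : Set Z, MeasurableSet A ∧ x = |(μ A).toReal - (ν A).toReal|}

/-- Discrepancy of a measure `α` on a product with respect to marginals `μ`, `ν`. -/
def discrepancy {X Y : Type*} [MeasurableSpace X] [MeasurableSpace Y]
    (α : Measure (X × Y)) (μ : Measure X) (ν : Measure Y) : ℝ :=
  tvDist (α.map Prod.fst) μ + tvDist (α.map Prod.snd) ν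

/-- A correspondence between `X` and `Y`: a Borel subset of `X × Y` whose two projections
are onto. -/
def IsCorrespondence {X Y : Type*} [MeasurableSpace X] [MeasurableSpace Y]
    (R : Set (X × Y)) : Prop :=
  MeasurableSet R ∧ (∀ x : X, ∃ y : Y, (x, y) ∈ R) ∧ (∀ y : Y, ∃ x : X, (x, y) ∈ R)

/-- The distortion of a relation `R ⊆ X × Y`. -/
def distortion {X Y : Type*} [MetricSpace X] [MetricSpace Y] (R : Set (X × Y)) : ℝ :=
  sSup {t : ℝ | ∃ p ∈ R, ∃ q ∈ R, t = |dist p.1 q.1 - dist p.2 q.2|}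

/-- Riesz representation on a compact metric space. -/
lemma aux_riesz {Z : Type*} [MetricSpace Z] [CompactSpace Z] [MeasurableSpace Z] [BorelSpace Z]
    (L : C(Z, ℝ) →ₗ[ℝ] ℝ) (hL : ∀ f : C(Z, ℝ), (∀ z, 0 ≤ f z) → 0 ≤ L f) :
    ∃ β : Measure Z, IsFiniteMeasure β ∧ ∀ f : C(Z, ℝ), ∫ z, f z ∂β = L f := by
  let J : CompactlySupportedContinuousMap Z ℝ →ₗ[ℝ] C(Z, ℝ) :=
    { toFun := fun f => f.toContinuousMap
      map_add' := fun f g => by ext; rfl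
      map_smul' := fun c f => by ext; rfl }
  let M : CompactlySupportedContinuousMap Z ℝ →ₚ[ℝ] ℝ :=
    PositiveLinearMap.mk₀ (L ∘ₗ J) (fun f hf => hL _ (fun z => hf z))
  refine ⟨RealRMK.rieszMeasure M, ?_, ?_⟩
  · infer_instance
  · intro f
    exact RealRMK.integral_rieszMeasure M
      (CompactlySupportedContinuousMap.continuousMapEquiv f)

/-- Comparison of measures through continuous test functions. -/
lemma aux_le {Z : Type*} [MetricSpace Z] [CompactSpace Z] [MeasurableSpace Z] [BorelSpace Z]
    (μ ν : Measure Z) [IsFiniteMeasure μ] [IsFiniteMeasure ν]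
    (h : ∀ f : C(Z, ℝ), (∀ z, 0 ≤ f z) → ∫ z, f z ∂μ ≤ ∫ z, f z ∂ν) : μ ≤ ν := by
  have hcl : ∀ F : Set Z, IsClosed F → μ F ≤ ν F := by
    intro F hF
    have hp : ∀ n : ℕ, (0 : ℝ) < 1 / ((n : ℝ) + 1) := fun n => by positivity
    have h0 : Tendsto (fun n : ℕ => 1 / ((n : ℝ) + 1)) atTop (𝓝 0) :=
      tendsto_one_div_add_atTop_nhds_zero_nat
    have h1 := tendsto_integral_thickenedIndicator_of_isClosed μ hF hp h0
    have h2 := tendsto_integral_thickenedIndicator_of_isClosed ν hF hp h0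
    have h3 : μ.real F ≤ ν.real F := by
      refine le_of_tendsto_of_tendsto' h1 h2 (fun n => ?_)
      exact h ⟨fun z => (thickenedIndicator (hp n) F z : ℝ), by fun_prop⟩
        (fun z => NNReal.coe_nonneg _)
    exact (ENNReal.toReal_le_toReal (measure_ne_top _ _) (measure_ne_top _ _)).1 h3
  refine Measure.le_iff.2 (fun A hA => ?_)
  rw [hA.measure_eq_iSup_isClosed_of_ne_top (measure_ne_top _ _)]
  refine iSup_le fun K => iSup_le fun hK => iSup_le fun hKc => ?_
  exact (hcl K hKc).trans (measure_mono hK)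

/-- The weak duality inequality, by the layer cake formula. -/
lemma aux_dual {X Y : Type*} [MetricSpace X] [CompactSpace X] [MeasurableSpace X] [BorelSpace X]
    [MetricSpace Y] [CompactSpace Y] [MeasurableSpace Y] [BorelSpace Y]
    (μ : Measure X) (ν : Measure Y) [IsFiniteMeasure μ] [IsFiniteMeasure ν]
    (R : Set (X × Y)) (ε : ℝ) (hε : 0 ≤ ε)
    (H : ∀ B : Set Y, IsClosed B → ν B ≤ μ {x | ∃ y ∈ B, (x, y) ∈ R} + ENNReal.ofReal ε)
    (u : C(X, ℝ)) (v : C(Y, ℝ)) (hu : ∀ x, 0 ≤ u x) (hv : ∀ y, 0 ≤ v y)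
    (huv : ∀ x y, (x, y) ∈ R → 1 ≤ u x + v y) :
    ν.real Set.univ - ε ≤ ∫ x, u x ∂μ + ∫ y, v y ∂ν := by
  have key : ∫⁻ y, ENNReal.ofReal (max (1 - v y) 0) ∂ν
      ≤ ∫⁻ x, ENNReal.ofReal (u x) ∂μ + ENNReal.ofReal ε := by
    rw [lintegral_eq_lintegral_meas_le (f := fun y => max (1 - v y) 0) ν
      (Eventually.of_forall fun y => le_max_right _ _)
      (by fun_prop), lintegral_eq_lintegral_meas_le μ (Eventually.of_forall hu) (by fun_prop)]
    have hb : ∀ t ∈ Set.Ioi (0 : ℝ), ν {y | t ≤ max (1 - v y) 0} ≤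
        μ {x | t ≤ u x} + (Set.Ioc (0 : ℝ) 1).indicator (fun _ => ENNReal.ofReal ε) t := by
      intro t ht
      have ht' : (0 : ℝ) < t := ht
      by_cases h1 : t ≤ 1
      · have hm : t ∈ Set.Ioc (0 : ℝ) 1 := ⟨ht, h1⟩
        rw [Set.indicator_of_mem hm]
        refine (H _ (isClosed_le (by fun_prop) (by fun_prop))).trans ?_
        refine add_le_add_left (measure_mono ?_) _
        rintro x ⟨y, hy, hxy⟩
        have h2 := huv x y hxy
        have hy' : t ≤ max (1 - v y) 0 := hy
        show t ≤ u x
        rcases le_max_iff.1 hy' with h | h <;> linarith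
      · have : {y | t ≤ max (1 - v y) 0} = ∅ := by
          ext y
          have := hv y
          simp only [Set.mem_empty_iff_false, iff_false]
          intro hy
          have hy' : t ≤ max (1 - v y) 0 := hy
          rcases le_max_iff.1 hy' with h | h <;> linarith
        rw [this]; simp
    calc _ ≤ ∫⁻ t in Set.Ioi (0 : ℝ), (μ {x | t ≤ u x} +
          (Set.Ioc (0 : ℝ) 1).indicator (fun _ => ENNReal.ofReal ε) t) :=
          setLIntegral_mono' measurableSet_Ioi hb
      _ = (∫⁻ t in Set.Ioi (0 : ℝ), μ {x | t ≤ u x}) +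
          ∫⁻ t in Set.Ioi (0 : ℝ), (Set.Ioc (0 : ℝ) 1).indicator (fun _ => ENNReal.ofReal ε) t :=
          lintegral_add_right _ (measurable_const.indicator measurableSet_Ioc)
      _ ≤ _ := by
          gcongr
          rw [lintegral_indicator measurableSet_Ioc, setLIntegral_const,
            Measure.restrict_apply measurableSet_Ioc]
          calc _ ≤ ENNReal.ofReal ε * volume (Set.Ioc (0 : ℝ) 1) := by
                gcongr; exact Set.inter_subset_left
            _ = _ := by simp
  have iu : Integrable (fun x => u x) μ := u.continuous.integrable_of_hasCompactSupport
    (HasCompactSupport.of_compactSpace _)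
  have iv : Integrable (fun x => v x) ν := v.continuous.integrable_of_hasCompactSupport
    (HasCompactSupport.of_compactSpace _)
  have im : Integrable (fun y => max (1 - v y) 0) ν :=
    Continuous.integrable_of_hasCompactSupport (by fun_prop)
      (HasCompactSupport.of_compactSpace _)
  rw [← ofReal_integral_eq_lintegral_ofReal im (Eventually.of_forall fun y => le_max_right _ _),
    ← ofReal_integral_eq_lintegral_ofReal iu (Eventually.of_forall hu),
    ← ENNReal.ofReal_add (integral_nonneg hu) hε,
    ENNReal.ofReal_le_ofReal_iff (add_nonneg (integral_nonneg hu) hε)] at key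
  have h1 : ν.real Set.univ ≤ ∫ y, max (1 - v y) 0 ∂ν + ∫ y, v y ∂ν := by
    rw [← integral_add im iv]
    calc ν.real Set.univ = ∫ y, (1 : ℝ) ∂ν := by simp
      _ ≤ _ := integral_mono (integrable_const _) (im.add iv) (fun y => by
        have := le_max_left (1 - v y) 0
        simp only [Pi.add_apply]
        linarith)
  linarith

/-- Strassen type theorem: sub-couplings supported on a closed relation. -/
lemma aux_strassen {X Y : Type*} [MetricSpace X] [CompactSpace X] [MeasurableSpace X]
    [BorelSpace X] [MetricSpace Y] [CompactSpace Y] [MeasurableSpace Y] [BorelSpace Y]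
    (μ : Measure X) (ν : Measure Y) [IsFiniteMeasure μ] [IsFiniteMeasure ν]
    (R : Set (X × Y)) (hR : IsClosed R) (hRne : R.Nonempty) (ε : ℝ) (hε : 0 ≤ ε)
    (H : ∀ B : Set Y, IsClosed B → ν B ≤ μ {x | ∃ y ∈ B, (x, y) ∈ R} + ENNReal.ofReal ε) :
    ∃ β : Measure (X × Y), IsFiniteMeasure β ∧ β.map Prod.fst ≤ μ ∧ β.map Prod.snd ≤ ν ∧
      β Rᶜ = 0 ∧ ν.real Set.univ - ε ≤ β.real Set.univ := by
  have hint : ∀ u : C(X, ℝ), Integrable (fun x => u x) μ := fun u =>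
    u.continuous.integrable_of_hasCompactSupport (HasCompactSupport.of_compactSpace _)
  have hint' : ∀ u : C(Y, ℝ), Integrable (fun x => u x) ν := fun u =>
    u.continuous.integrable_of_hasCompactSupport (HasCompactSupport.of_compactSpace _)
  let S : C(X × Y, ℝ) → Set ℝ := fun h => {t | ∃ (u : C(X, ℝ)) (v : C(Y, ℝ)),
    (∀ x, 0 ≤ u x) ∧ (∀ y, 0 ≤ v y) ∧ (∀ x y, (x, y) ∈ R → h (x, y) ≤ u x + v y) ∧
    t = ∫ x, u x ∂μ + ∫ y, v y ∂ν}
  let p : C(X × Y, ℝ) → ℝ := fun h => sInf (S h)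
  have Sbdd : ∀ h, BddBelow (S h) := by
    intro h
    refine ⟨0, ?_⟩
    rintro t ⟨u, v, hu, hv, -, rfl⟩
    exact add_nonneg (integral_nonneg hu) (integral_nonneg hv)
  have Sne : ∀ h, (S h).Nonempty := by
    intro h
    refine ⟨_, ContinuousMap.const X ‖h‖, 0, fun x => norm_nonneg h, fun y => le_rfl, ?_, rfl⟩
    intro x y _
    simpa using (le_abs_self _).trans (h.norm_coe_le_norm (x, y))
  have hp_le : ∀ h (u : C(X, ℝ)) (v : C(Y, ℝ)), (∀ x, 0 ≤ u x) → (∀ y, 0 ≤ v y) →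
      (∀ x y, (x, y) ∈ R → h (x, y) ≤ u x + v y) → p h ≤ ∫ x, u x ∂μ + ∫ y, v y ∂ν :=
    fun h u v hu hv huv => csInf_le (Sbdd h) ⟨u, v, hu, hv, huv, rfl⟩
  have hp_nonpos : ∀ h : C(X × Y, ℝ), (∀ q ∈ R, h q ≤ 0) → p h ≤ 0 := by
    intro h hh
    have := hp_le h 0 0 (fun _ => le_rfl) (fun _ => le_rfl)
      (fun x y hxy => by simpa using hh _ hxy)
    simpa using this
  have p_add : ∀ h k, p (h + k) ≤ p h + p k := by
    intro h k
    refine le_of_forall_pos_lt_add (fun e he => ?_)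
    obtain ⟨s, ⟨u, v, hu, hv, huv, rfl⟩, hs⟩ :=
      exists_lt_of_csInf_lt (Sne h) (lt_add_of_pos_right (p h) (half_pos he))
    obtain ⟨t, ⟨u', v', hu', hv', huv', rfl⟩, ht⟩ :=
      exists_lt_of_csInf_lt (Sne k) (lt_add_of_pos_right (p k) (half_pos he))
    have := hp_le (h + k) (u + u') (v + v') (fun x => add_nonneg (hu x) (hu' x))
      (fun x => add_nonneg (hv x) (hv' x)) (fun x y hxy => by
        have h1 := huv x y hxy
        have h2 := huv' x y hxy
        simp only [ContinuousMap.add_apply]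
        linarith)
    simp only [ContinuousMap.add_apply] at this
    rw [integral_add (hint u) (hint u'), integral_add (hint' v) (hint' v')] at this
    linarith
  have p_hom_le : ∀ c : ℝ, 0 < c → ∀ h, p (c • h) ≤ c * p h := by
    intro c hc h
    rw [← div_le_iff₀' hc]
    refine le_csInf (Sne h) ?_
    rintro t ⟨u, v, hu, hv, huv, rfl⟩
    rw [div_le_iff₀' hc]
    have := hp_le (c • h) (c • u) (c • v) (fun x => mul_nonneg hc.le (hu x))
      (fun x => mul_nonneg hc.le (hv x)) (fun x y hxy => by
        have h1 := mul_le_mul_of_nonneg_left (huv x y hxy) hc.le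
        simp only [ContinuousMap.smul_apply, smul_eq_mul]
        linarith)
    simp only [ContinuousMap.smul_apply, smul_eq_mul, integral_const_mul] at this
    linarith
  have p_hom : ∀ c : ℝ, 0 < c → ∀ h, p (c • h) = c * p h := by
    intro c hc h
    refine le_antisymm (p_hom_le c hc h) ?_
    have := p_hom_le c⁻¹ (inv_pos.2 hc) (c • h)
    rw [smul_smul, inv_mul_cancel₀ hc.ne', one_smul] at this
    calc c * p h ≤ c * (c⁻¹ * p (c • h)) := by gcongr
      _ = _ := by field_simp
  have p_zero : p 0 = 0 := by
    have := p_hom 2 (by norm_num) 0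
    rw [smul_zero] at this
    linarith
  have hone : (1 : C(X × Y, ℝ)) ≠ 0 := by
    obtain ⟨q, -⟩ := hRne
    intro h
    have := DFunLike.congr_fun h q
    simp at this
  obtain ⟨L, hL1, hLp⟩ := exists_extension_of_le_sublinear
    (LinearPMap.mkSpanSingleton (1 : C(X × Y, ℝ)) (p 1) hone) p p_hom p_add (by
      rintro ⟨x, hx⟩
      obtain ⟨c, rfl⟩ := Submodule.mem_span_singleton.1 hx
      rw [LinearPMap.mkSpanSingleton'_apply]
      simp only [RingHom.id_apply, smul_eq_mul]
      rcases lt_trichotomy c 0 with hc | hc | hc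
      · have h1 := p_hom (-c) (by linarith) 1
        have h2 := p_add (c • 1) (-c • 1)
        rw [← add_smul, add_neg_cancel, zero_smul, p_zero, h1] at h2
        linarith
      · subst hc; simp [p_zero]
      · exact (p_hom c hc 1).ge)
  have hL1' : L 1 = p 1 := by
    have := hL1 ⟨1, Submodule.mem_span_singleton_self _⟩
    rw [this]
    exact LinearPMap.mkSpanSingleton_apply ℝ ℝ hone _
  obtain ⟨β, hβf, hβ⟩ := aux_riesz L (fun f hf => by
    have h1 := (hLp (-f)).trans (hp_nonpos (-f) (fun q _ => by simpa using hf q))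
    rw [map_neg] at h1
    linarith)
  refine ⟨β, hβf, ?_, ?_, ?_, ?_⟩
  · refine aux_le _ _ (fun u hu => ?_)
    rw [integral_map measurable_fst.aemeasurable (by fun_prop)]
    have h1 := hβ (u.comp ⟨Prod.fst, continuous_fst⟩)
    have h2 := hp_le (u.comp ⟨Prod.fst, continuous_fst⟩) u 0 hu (fun _ => le_rfl)
      (fun x y _ => by simp)
    have h3 := hLp (u.comp ⟨Prod.fst, continuous_fst⟩)
    simp only [ContinuousMap.comp_apply, ContinuousMap.coe_mk] at h1
    rw [h1]
    simpa using h3.trans h2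
  · refine aux_le _ _ (fun u hu => ?_)
    rw [integral_map measurable_snd.aemeasurable (by fun_prop)]
    have h1 := hβ (u.comp ⟨Prod.snd, continuous_snd⟩)
    have h2 := hp_le (u.comp ⟨Prod.snd, continuous_snd⟩) 0 u (fun _ => le_rfl) hu
      (fun x y _ => by simp)
    have h3 := hLp (u.comp ⟨Prod.snd, continuous_snd⟩)
    simp only [ContinuousMap.comp_apply, ContinuousMap.coe_mk] at h1
    rw [h1]
    simpa using h3.trans h2
  · let k : C(X × Y, ℝ) := ⟨fun q => Metric.infDist q R, Metric.continuous_infDist_pt R⟩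
    have h1 : ∫ q, k q ∂β ≤ 0 := by
      rw [hβ]
      exact (hLp k).trans (hp_nonpos k (fun q hq => (Metric.infDist_zero_of_mem hq).le))
    have hk0 : ∀ q, 0 ≤ k q := fun q => Metric.infDist_nonneg
    have h2 : ∫ q, k q ∂β = 0 := le_antisymm h1 (integral_nonneg hk0)
    rw [integral_eq_zero_iff_of_nonneg hk0
      (k.continuous.integrable_of_hasCompactSupport (HasCompactSupport.of_compactSpace _))] at h2
    refine measure_mono_null ?_ (ae_iff.1 h2)
    intro q hq hq'
    exact hq ((hR.mem_iff_infDist_zero hRne).2 hq')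
  · have h1 := hβ 1
    have h2 : ∫ q, (1 : C(X × Y, ℝ)) q ∂β = β.real Set.univ := by simp
    rw [← h2, h1, hL1']
    refine le_csInf (Sne 1) ?_
    rintro t ⟨u, v, hu, hv, huv, rfl⟩
    exact aux_dual μ ν R ε hε H u v hu hv (fun x y hxy => by simpa using huv x y hxy)

lemma aux_tv_self {Z : Type*} [MeasurableSpace Z] (μ : Measure Z) : tvDist μ μ ≤ 0 := by
  refine csSup_le ⟨_, ∅, MeasurableSet.empty, rfl⟩ ?_
  rintro x ⟨A, -, rfl⟩
  simp

lemma aux_tv_le {Z : Type*} [MeasurableSpace Z] (μ ν : Measure Z) [IsFiniteMeasure μ]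
    [IsFiniteMeasure ν] (h : μ ≤ ν) :
    tvDist μ ν ≤ ν.real Set.univ - μ.real Set.univ := by
  refine csSup_le ⟨_, ∅, MeasurableSet.empty, rfl⟩ ?_
  rintro x ⟨A, hA, rfl⟩
  have h1 : ∀ B, μ.real B ≤ ν.real B := fun B =>
    ENNReal.toReal_mono (measure_ne_top _ _) (h B)
  have h2 := h1 A
  have h3 := h1 Aᶜ
  have h4 := measureReal_add_measureReal_compl (μ := μ) hA
  have h5 := measureReal_add_measureReal_compl (μ := ν) hA
  change |μ.real A - ν.real A| ≤ _
  rw [abs_of_nonpos (by linarith)]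
  linarith

/-- Completion of a sub-coupling. -/
lemma aux_complete {X Y : Type*} [MeasurableSpace X] [MeasurableSpace Y]
    (μ : Measure X) (ν : Measure Y) [IsFiniteMeasure μ] [IsFiniteMeasure ν]
    (hle : μ Set.univ ≤ ν Set.univ)
    (R : Set (X × Y)) (ε : ℝ) (β : Measure (X × Y)) [IsFiniteMeasure β]
    (h1 : β.map Prod.fst ≤ μ) (h2 : β.map Prod.snd ≤ ν) (h3 : β Rᶜ = 0)
    (h4 : ν.real Set.univ - ε ≤ β.real Set.univ) :
    ∃ α : Measure (X × Y), discrepancy α μ ν + (α Rᶜ).toReal ≤ ε ∧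
      α.map Prod.fst = μ ∧ α.map Prod.snd ≤ ν := by
  set μ' := μ - β.map Prod.fst with hμ'
  set ν' := ν - β.map Prod.snd with hν'
  have e1 : μ' + β.map Prod.fst = μ := Measure.sub_add_cancel_of_le h1
  have e2 : ν' + β.map Prod.snd = ν := Measure.sub_add_cancel_of_le h2
  have b1 : (β.map Prod.fst) Set.univ = β Set.univ := by
    rw [Measure.map_apply measurable_fst MeasurableSet.univ, Set.preimage_univ]
  have b2 : (β.map Prod.snd) Set.univ = β Set.univ := by
    rw [Measure.map_apply measurable_snd MeasurableSet.univ, Set.preimage_univ]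
  have hmm : μ' Set.univ ≤ ν' Set.univ := by
    rw [← e1, ← e2, Measure.add_apply, Measure.add_apply, b1, b2] at hle
    exact (ENNReal.add_le_add_iff_right (measure_ne_top _ _)).1 hle
  have hm : ν' Set.univ ≠ ⊤ := by
    have : ν' Set.univ ≤ ν Set.univ := by
      rw [← e2, Measure.add_apply]; exact le_self_add
    exact ne_top_of_le_ne_top (measure_ne_top _ _) this
  have : IsFiniteMeasure ν' := ⟨hm.lt_top⟩
  have : IsFiniteMeasure μ' := ⟨hmm.trans_lt hm.lt_top⟩
  set γ := (ν' Set.univ)⁻¹ • μ'.prod ν' with hγ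
  have g1 : γ.map Prod.fst = μ' := by
    rw [hγ, Measure.map_smul, Measure.map_fst_prod, smul_smul]
    by_cases h0 : ν' Set.univ = 0
    · have : μ' = 0 := Measure.measure_univ_eq_zero.1 (le_antisymm (hmm.trans h0.le) bot_le)
      rw [this, smul_zero]
    · rw [ENNReal.inv_mul_cancel h0 hm, one_smul]
  have g2 : γ.map Prod.snd ≤ ν' := by
    rw [hγ, Measure.map_smul, Measure.map_snd_prod, smul_smul]
    refine Measure.le_iff.2 fun A _ => ?_
    rw [Measure.smul_apply, smul_eq_mul]
    calc _ ≤ 1 * ν' A := by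
          gcongr
          rw [mul_comm, ← div_eq_mul_inv]
          exact ENNReal.div_le_of_le_mul (by simpa using hmm)
      _ = _ := one_mul _
  have a1 : (β + γ).map Prod.fst = μ := by
    rw [Measure.map_add _ _ measurable_fst, g1, add_comm, e1]
  have a2 : (β + γ).map Prod.snd ≤ ν := by
    rw [Measure.map_add _ _ measurable_snd, add_comm]
    conv_rhs => rw [← e2]
    gcongr
  refine ⟨β + γ, ?_, a1, a2⟩
  have u1 : β Set.univ + γ Set.univ = μ Set.univ := by
    conv_rhs => rw [← a1]
    rw [Measure.map_apply measurable_fst MeasurableSet.univ, Set.preimage_univ,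
      Measure.add_apply]
  have : IsFiniteMeasure γ := ⟨by
    refine lt_of_le_of_lt ?_ (measure_lt_top μ Set.univ)
    rw [← u1]; exact le_add_self⟩
  have u2 : ((β + γ).map Prod.snd).real Set.univ = μ.real Set.univ := by
    rw [measureReal_def, Measure.map_apply measurable_snd MeasurableSet.univ, Set.preimage_univ,
      Measure.add_apply, u1, measureReal_def]
  have t1 := aux_tv_self μ
  have t2 := aux_tv_le _ _ a2
  rw [u2] at t2
  have u3 : ((β + γ) Rᶜ).toReal ≤ μ.real Set.univ - β.real Set.univ := by
    rw [Measure.add_apply, h3, zero_add, measureReal_def, ← u1,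
      ENNReal.toReal_add (measure_ne_top _ _) (measure_ne_top _ _), measureReal_def]
    have := ENNReal.toReal_mono (measure_ne_top γ _) (measure_mono (Set.subset_univ Rᶜ))
    linarith
  unfold discrepancy
  rw [a1]
  linarith

open scoped BoundedContinuousFunction

/-- Properties of the cross distance coming from an embedding. -/
structure AuxGood (𝒳 𝒴 : PMM) (D : 𝒳.carrier × 𝒴.carrier → ℝ) (r : ℝ) : Prop where
  nonneg : ∀ p, 0 ≤ D p
  lip : ∀ p q, |D p - D q| ≤ 2 * dist p q
  tri : ∀ p q, |dist p.1 q.1 - dist p.2 q.2| ≤ D p + D q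
  root : D (𝒳.basepoint, 𝒴.basepoint) ≤ r
  left : ∀ x, ∃ y, D (x, y) ≤ r
  right : ∀ y, ∃ x, D (x, y) ≤ r
  meas : ∀ B : Set 𝒴.carrier, IsClosed B →
    𝒴.meas B ≤ 𝒳.meas {x | ∃ y ∈ B, D (x, y) ≤ r} + ENNReal.ofReal r

lemma aux_value_nonneg {𝒳 𝒴 : PMM} (e : GHPEmbedding 𝒳 𝒴) : 0 ≤ e.value :=
  le_max_of_le_left dist_nonneg

lemma aux_cGHP_nonneg (𝒳 𝒴 : PMM) : 0 ≤ cGHP 𝒳 𝒴 := by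
  refine Real.sInf_nonneg ?_
  rintro x ⟨e, -, rfl⟩
  exact aux_value_nonneg e

lemma aux_exists_embedding (𝒳 𝒴 : PMM) (h𝒳 : 𝒳.IsCompactPMM) (h𝒴 : 𝒴.IsCompactPMM) :
    ∃ e : GHPEmbedding 𝒳 𝒴, e.IsIsometric :=
  have := h𝒳.1
  have := h𝒴.1
  ⟨⟨𝒳.carrier ⊕ 𝒴.carrier, Metric.metricSpaceSum, Sum.inl, Sum.inr⟩,
    Metric.isometry_inl, Metric.isometry_inr⟩

lemma aux_good_of_embedding {𝒳 𝒴 : PMM} (h𝒳 : 𝒳.IsCompactPMM) (h𝒴 : 𝒴.IsCompactPMM)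
    (e : GHPEmbedding 𝒳 𝒴) (he : e.IsIsometric) (r : ℝ) (hr : e.value < r) :
    AuxGood 𝒳 𝒴 (fun p => dist (e.f p.1) (e.g p.2)) r := by
  have := h𝒳.1
  have := h𝒴.1
  have : Nonempty 𝒳.carrier := ⟨𝒳.basepoint⟩
  have : Nonempty 𝒴.carrier := ⟨𝒴.basepoint⟩
  obtain ⟨hf, hg⟩ := he
  let _ : MeasurableSpace e.Z := borel e.Z
  have : BorelSpace e.Z := ⟨rfl⟩
  obtain ⟨v1, v2⟩ := max_lt_iff.1 hr
  obtain ⟨v2, v3⟩ := max_lt_iff.1 v2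
  have hfin : Metric.hausdorffEDist (Set.range e.f) (Set.range e.g) ≠ ⊤ :=
    Metric.hausdorffEDist_ne_top_of_nonempty_of_bounded (Set.range_nonempty _)
      (Set.range_nonempty _) (isCompact_range hf.continuous).isBounded
      (isCompact_range hg.continuous).isBounded
  refine ⟨fun p => dist_nonneg, ?_, ?_, v1.le, ?_, ?_, ?_⟩
  · rintro ⟨x, y⟩ ⟨x', y'⟩
    have h1 : dist x x' ≤ dist (x, y) (x', y') := le_max_left _ _
    have h2 : dist y y' ≤ dist (x, y) (x', y') := le_max_right _ _
    have h3 := abs_dist_sub_le (e.f x) (e.f x') (e.g y)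
    have h4 := abs_dist_sub_le (e.g y) (e.g y') (e.f x')
    rw [hf.dist_eq] at h3
    rw [hg.dist_eq, dist_comm (e.g y), dist_comm (e.g y')] at h4
    rw [abs_le] at *
    constructor <;> simp only <;> linarith [h3.1, h3.2, h4.1, h4.2]
  · rintro ⟨x, y⟩ ⟨x', y'⟩
    simp only
    rw [← hf.dist_eq, ← hg.dist_eq, abs_le]
    have h1 := dist_triangle4 (e.f x) (e.g y) (e.g y') (e.f x')
    have h2 := dist_triangle4 (e.g y) (e.f x) (e.f x') (e.g y')
    rw [dist_comm (e.g y') (e.f x')] at h1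
    rw [dist_comm (e.g y) (e.f x)] at h2
    constructor <;> linarith
  · intro x
    obtain ⟨_, ⟨y, rfl⟩, hy⟩ :=
      Metric.exists_dist_lt_of_hausdorffDist_lt (Set.mem_range_self x) v2 hfin
    exact ⟨y, hy.le⟩
  · intro y
    obtain ⟨_, ⟨x, rfl⟩, hy⟩ :=
      Metric.exists_dist_lt_of_hausdorffDist_lt' (Set.mem_range_self y) v2 hfin
    exact ⟨x, hy.le⟩
  · intro B hB
    obtain ⟨s, ⟨hs0, hs⟩, hsr⟩ := exists_lt_of_csInf_lt (by
      refine ⟨max 1 (max (𝒳.meas Set.univ).toReal (𝒴.meas Set.univ).toReal),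
        lt_max_of_lt_left one_pos, fun A hA => ⟨?_, ?_⟩⟩
      · refine le_trans ?_ le_add_self
        rw [Measure.map_apply hf.continuous.measurable hA.measurableSet]
        refine (measure_mono (Set.subset_univ _)).trans ?_
        refine (ENNReal.le_ofReal_iff_toReal_le h𝒳.2 (by positivity)).2 ?_
        exact le_max_of_le_right (le_max_left _ _)
      · refine le_trans ?_ le_add_self
        rw [Measure.map_apply hg.continuous.measurable hA.measurableSet]
        refine (measure_mono (Set.subset_univ _)).trans ?_
        refine (ENNReal.le_ofReal_iff_toReal_le h𝒴.2 (by positivity)).2 ?_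
        exact le_max_of_le_right (le_max_right _ _)) v3
    have hBc : IsCompact (e.g '' B) := hB.isCompact.image hg.continuous
    have h := (hs (e.g '' B) hBc.isClosed).2
    rw [Measure.map_apply hg.continuous.measurable hBc.isClosed.measurableSet,
      Set.preimage_image_eq _ hg.injective,
      Measure.map_apply hf.continuous.measurable Metric.isClosed_cthickening.measurableSet] at h
    refine h.trans (add_le_add (measure_mono ?_) (ENNReal.ofReal_le_ofReal hsr.le))
    intro x hx
    rw [Set.mem_preimage, hBc.cthickening_eq_biUnion_closedBall hs0.le, Set.mem_iUnion₂] at hx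
    obtain ⟨_, ⟨y, hy, rfl⟩, hxy⟩ := hx
    exact ⟨y, hy, (Metric.mem_closedBall.1 hxy).trans hsr.le⟩

/-- The infimum in the definition of `cGHP` gives a limiting cross distance. -/
lemma aux_limit {𝒳 𝒴 : PMM} (h𝒳 : 𝒳.IsCompactPMM) (h𝒴 : 𝒴.IsCompactPMM) :
    ∃ D : 𝒳.carrier × 𝒴.carrier → ℝ, Continuous D ∧ AuxGood 𝒳 𝒴 D (cGHP 𝒳 𝒴) := by
  have := h𝒳.1
  have := h𝒴.1
  have : IsFiniteMeasure 𝒳.meas := ⟨h𝒳.2.lt_top⟩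
  set ε := cGHP 𝒳 𝒴 with hε
  have hex : ∀ s : ℝ, 0 < s → ∃ F : 𝒳.carrier × 𝒴.carrier →ᵇ ℝ, AuxGood 𝒳 𝒴 F (ε + s) := by
    intro s hs
    obtain ⟨e₀, he₀⟩ := aux_exists_embedding 𝒳 𝒴 h𝒳 h𝒴
    obtain ⟨_, ⟨e, he, rfl⟩, hlt⟩ := exists_lt_of_csInf_lt
      (s := {x : ℝ | ∃ e : GHPEmbedding 𝒳 𝒴, e.IsIsometric ∧ x = e.value})
      ⟨_, e₀, he₀, rfl⟩ (lt_add_of_pos_right ε hs)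
    exact ⟨BoundedContinuousFunction.mkOfCompact ⟨fun p => dist (e.f p.1) (e.g p.2),
      (he.1.continuous.comp continuous_fst).dist (he.2.continuous.comp continuous_snd)⟩,
      aux_good_of_embedding h𝒳 h𝒴 e he _ hlt⟩
  have hsp : ∀ n : ℕ, (0 : ℝ) < 1 / ((n : ℝ) + 1) := fun n => by positivity
  have hs1 : ∀ n : ℕ, 1 / ((n : ℝ) + 1) ≤ 1 := fun n => by
    rw [div_le_one (by positivity)]; linarith [n.cast_nonneg (α := ℝ)]
  have hs0 : Tendsto (fun n : ℕ => 1 / ((n : ℝ) + 1)) atTop (𝓝 0) :=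
    tendsto_one_div_add_atTop_nhds_zero_nat
  choose F hF using fun n : ℕ => hex _ (hsp n)
  set C : ℝ := ε + 1 + 2 * Metric.diam (Set.univ : Set (𝒳.carrier × 𝒴.carrier)) with hC
  let A : Set (𝒳.carrier × 𝒴.carrier →ᵇ ℝ) :=
    {f | ∀ p q, f p ∈ Set.Icc 0 C ∧ |f p - f q| ≤ 2 * dist p q}
  have hAc : IsClosed A := by
    have hev : ∀ p, Continuous fun f : 𝒳.carrier × 𝒴.carrier →ᵇ ℝ => f p := fun p =>
      continuous_eval_const p
    have : A = ⋂ p, ⋂ q, {f | f p ∈ Set.Icc 0 C} ∩ {f | |f p - f q| ≤ 2 * dist p q} := by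
      ext f; simp [A]
    rw [this]
    refine isClosed_iInter fun p => isClosed_iInter fun q => IsClosed.inter ?_ ?_
    · exact isClosed_Icc.preimage (hev p)
    · exact isClosed_le (((hev p).sub (hev q)).abs) continuous_const
  have hAk : IsCompact A := by
    refine BoundedContinuousFunction.arzela_ascoli₂ (Set.Icc 0 C) isCompact_Icc A hAc
      (fun f x hf => (hf x x).1) ?_
    refine Metric.equicontinuous_of_continuity_modulus (fun t => 2 * t) ?_ _ ?_
    · have : Tendsto (fun t : ℝ => 2 * t) (𝓝 0) (𝓝 (2 * 0)) := tendsto_id.const_mul 2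
      simpa using this
    · rintro x y ⟨f, hf⟩
      exact (hf x y).2
  have hFA : ∀ n, F n ∈ A := by
    intro n p q
    refine ⟨⟨(hF n).nonneg p, ?_⟩, (hF n).lip p q⟩
    have h1 := (abs_le.1 ((hF n).lip p (𝒳.basepoint, 𝒴.basepoint))).2
    have h2 := (hF n).root
    have h3 := Metric.dist_le_diam_of_mem (isCompact_univ.isBounded)
      (Set.mem_univ p) (Set.mem_univ (𝒳.basepoint, 𝒴.basepoint))
    linarith [hs1 n]
  obtain ⟨f, hfA, φ, hφ, hlim⟩ := hAk.tendsto_subseq hFA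
  have hcl : ∀ s : ℝ, 0 < s → ∃ n : ℕ, 1 / ((n : ℝ) + 1) < s ∧ ∀ p, |f p - F n p| ≤ s := by
    intro s hs
    have h1 := (hs0.comp hφ.tendsto_atTop).eventually (gt_mem_nhds hs)
    have h2 := hlim.eventually (Metric.ball_mem_nhds f hs)
    obtain ⟨n, hn1, hn2⟩ := (h1.and h2).exists
    refine ⟨φ n, hn1, fun p => ?_⟩
    have := BoundedContinuousFunction.dist_coe_le_dist (f := f) (g := F (φ n)) p
    rw [Real.dist_eq] at this
    exact this.trans (by rw [dist_comm]; exact hn2.le)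
  have hfc : Continuous f := f.continuous
  have hle_of : ∀ a b : ℝ, (∀ s : ℝ, 0 < s → a ≤ b + 2 * s) → a ≤ b := by
    intro a b h
    refine le_of_forall_pos_le_add fun s hs => ?_
    have := h (s / 2) (half_pos hs)
    linarith
  refine ⟨f, hfc, fun p => (hfA p p).1.1, fun p q => (hfA p q).2, ?_, ?_, ?_, ?_, ?_⟩
  · intro p q
    refine hle_of _ _ fun s hs => ?_
    obtain ⟨n, -, hn⟩ := hcl s hs
    have h1 := (hF n).tri p q
    have h2 := (abs_le.1 (hn p)).1
    have h3 := (abs_le.1 (hn q)).1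
    linarith
  · refine hle_of _ _ fun s hs => ?_
    obtain ⟨n, hn1, hn⟩ := hcl s hs
    have h1 := (hF n).root
    have h2 := (abs_le.1 (hn (𝒳.basepoint, 𝒴.basepoint))).2
    linarith
  · intro x
    obtain ⟨y, -, hy⟩ := isCompact_univ.exists_isMinOn ⟨𝒴.basepoint, Set.mem_univ _⟩
      (f := fun y => f (x, y)) (by fun_prop)
    refine ⟨y, hle_of _ _ fun s hs => ?_⟩
    obtain ⟨n, hn1, hn⟩ := hcl s hs
    obtain ⟨y', hy'⟩ := (hF n).left x
    have h2 := (abs_le.1 (hn (x, y'))).2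
    have h3 : f (x, y) ≤ f (x, y') := hy (Set.mem_univ y')
    linarith
  · intro y
    obtain ⟨x, -, hx⟩ := isCompact_univ.exists_isMinOn ⟨𝒳.basepoint, Set.mem_univ _⟩
      (f := fun x => f (x, y)) (by fun_prop)
    refine ⟨x, hle_of _ _ fun s hs => ?_⟩
    obtain ⟨n, hn1, hn⟩ := hcl s hs
    obtain ⟨x', hx'⟩ := (hF n).right y
    have h2 := (abs_le.1 (hn (x', y))).2
    have h3 : f (x, y) ≤ f (x', y) := hx (Set.mem_univ x')
    linarith
  · intro B hB
    let K : ℝ → Set 𝒳.carrier := fun t => {x | ∃ y ∈ B, f (x, y) ≤ t}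
    have hKmono : ∀ a b, a ≤ b → K a ⊆ K b := by
      rintro a b hab x ⟨y, hy, hxy⟩
      exact ⟨y, hy, hxy.trans hab⟩
    have hKc : ∀ t, IsClosed (K t) := by
      intro t
      have : K t = Prod.fst '' ({p | f p ≤ t} ∩ Prod.snd ⁻¹' B) := by
        ext x
        constructor
        · rintro ⟨y, hy, hxy⟩
          exact ⟨(x, y), ⟨hxy, hy⟩, rfl⟩
        · rintro ⟨⟨x', y⟩, ⟨hxy, hy⟩, rfl⟩
          exact ⟨y, hy, hxy⟩
      rw [this]
      exact ((((isClosed_le hfc continuous_const).inter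
        (hB.preimage continuous_snd)).isCompact).image continuous_fst).isClosed
    have hb : ∀ s : ℝ, 0 < s →
        𝒴.meas B ≤ 𝒳.meas (K (ε + 2 * s)) + ENNReal.ofReal (ε + s) := by
      intro s hs
      obtain ⟨n, hn1, hn⟩ := hcl s hs
      refine ((hF n).meas B hB).trans (add_le_add (measure_mono ?_)
        (ENNReal.ofReal_le_ofReal (by linarith)))
      rintro x ⟨y, hy, hxy⟩
      refine ⟨y, hy, ?_⟩
      have h2 := (abs_le.1 (hn (x, y))).2
      linarith
    have hanti : Antitone fun n : ℕ => K (ε + 2 * (1 / ((n : ℝ) + 1))) := by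
      intro m n hmn
      refine hKmono _ _ ?_
      gcongr
    have hT := tendsto_measure_iInter_atTop (μ := 𝒳.meas)
      (fun n : ℕ => (hKc (ε + 2 * (1 / ((n : ℝ) + 1)))).measurableSet.nullMeasurableSet) hanti
      ⟨0, measure_ne_top _ _⟩
    have hT2 : Tendsto (fun n : ℕ => ENNReal.ofReal (ε + 1 / ((n : ℝ) + 1))) atTop
        (𝓝 (ENNReal.ofReal ε)) := by
      refine ENNReal.tendsto_ofReal ?_
      simpa using hs0.const_add ε
    have hfinal := ge_of_tendsto' (hT.add hT2) (fun n => hb _ (hsp n))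
    refine hfinal.trans (add_le_add (measure_mono ?_) le_rfl)
    intro x hx
    rw [Set.mem_iInter] at hx
    have hBne : B.Nonempty := by
      obtain ⟨y, hy, -⟩ := hx 0
      exact ⟨y, hy⟩
    obtain ⟨y, hyB, hy⟩ := hB.isCompact.exists_isMinOn hBne
      (f := fun y => f (x, y)) (by fun_prop)
    refine ⟨y, hyB, ?_⟩
    have hl : Tendsto (fun n : ℕ => ε + 2 * (1 / ((n : ℝ) + 1))) atTop (𝓝 ε) := by
      simpa using (hs0.const_mul 2).const_add ε
    refine ge_of_tendsto' hl fun n => ?_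
    obtain ⟨y', hy'B, hy'⟩ := hx n
    exact (hy hy'B).trans hy'

/-- For compact pmm spaces `𝒳`, `𝒴` with `‖μ_X‖ ≤ ‖μ_Y‖` and `ε := dc(𝒳,𝒴)`, there are a
correspondence `R` containing the roots and a finite Borel measure `α` on the product with
`dis(R) ≤ 2ε`, `D(α;μ_X,μ_Y) + α(Rᶜ) ≤ ε`, `π₁_*α = μ_X` and `π₂_*α ≤ μ_Y`. -/
theorem cGHP_strassen_marginals (𝒳 𝒴 : PMM) (h𝒳 : 𝒳.IsCompactPMM) (h𝒴 : 𝒴.IsCompactPMM)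
    (hle : 𝒳.meas Set.univ ≤ 𝒴.meas Set.univ) :
    ∃ (R : Set (𝒳.carrier × 𝒴.carrier)) (α : Measure (𝒳.carrier × 𝒴.carrier)),
      IsCorrespondence R ∧ (𝒳.basepoint, 𝒴.basepoint) ∈ R ∧
      distortion R ≤ 2 * cGHP 𝒳 𝒴 ∧
      discrepancy α 𝒳.meas 𝒴.meas + (α Rᶜ).toReal ≤ cGHP 𝒳 𝒴 ∧
      α.map Prod.fst = 𝒳.meas ∧ α.map Prod.snd ≤ 𝒴.meas := by
  have := h𝒳.1
  have := h𝒴.1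
  have : IsFiniteMeasure 𝒳.meas := ⟨h𝒳.2.lt_top⟩
  have : IsFiniteMeasure 𝒴.meas := ⟨h𝒴.2.lt_top⟩
  obtain ⟨D, hDc, hD⟩ := aux_limit h𝒳 h𝒴
  have hRc : IsClosed {p | D p ≤ cGHP 𝒳 𝒴} := isClosed_le hDc continuous_const
  obtain ⟨β, hβ, b1, b2, b3, b4⟩ := aux_strassen 𝒳.meas 𝒴.meas {p | D p ≤ cGHP 𝒳 𝒴} hRc
    ⟨_, hD.root⟩ (cGHP 𝒳 𝒴) (aux_cGHP_nonneg 𝒳 𝒴) hD.meas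
  obtain ⟨α, a1, a2, a3⟩ := aux_complete 𝒳.meas 𝒴.meas hle {p | D p ≤ cGHP 𝒳 𝒴}
    (cGHP 𝒳 𝒴) β b1 b2 b3 b4
  refine ⟨{p | D p ≤ cGHP 𝒳 𝒴}, α, ⟨hRc.measurableSet, hD.left, hD.right⟩, hD.root, ?_,
    a1, a2, a3⟩
  refine csSup_le ⟨_, _, hD.root, _, hD.root, rfl⟩ ?_
  rintro t ⟨p, hp, q, hq, rfl⟩
  have h1 := hD.tri p q
  have hp' : D p ≤ cGHP 𝒳 𝒴 := hp
  have hq' : D q ≤ cGHP 𝒳 𝒴 := hq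
  linarith

end
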